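/- arXiv:1308.0797 — 5 statements merged into one kernel-verified Lean document; each statement's English description precedes it below -/
import Mathlib

section
/- The squared L² norm of g satisfies ∫₀ᵀ g(τ)² dτ = ω_c · sinh(ω_c d) · sinh(ω_c(T−d)) / sinh(ω_c T). -/
/-- The integral of the square of a scaled exponential over an interval. -/
theorem integral_sq_const_mul_exp (c K a b : ℝ) (hc : c ≠ 0) :
    ∫ x in a..b, (K * Real.exp (c * x)) ^ 2 =
      K ^ 2 * (Real.exp (c * b) ^ 2 - Real.exp (c * a) ^ 2) / (2 * c) := by
  have hsq (x : ℝ) : Real.exp (c * x) ^ 2 = Real.exp (2 * c * x) := by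
    rw [← Real.exp_nat_mul]
    push_cast
    ring_nf
  simp only [mul_pow, hsq]
  rw [intervalIntegral.integral_const_mul,
    intervalIntegral.integral_comp_mul_left (fun x => Real.exp x) (by positivity : 2 * c ≠ 0),
    integral_exp, smul_eq_mul]
  ring

/-- with `g(τ) = ω_c (𝟙_{[0,T−d)}(τ) e^{−ω_c(T−d−τ)} − a₀(d) e^{−ω_c(T−τ)})`
and `a₀(d) = sinh(ω_c(T−d))/sinh(ω_c T)`, one has
`∫₀ᵀ g(τ)² dτ = ω_c · sinh(ω_c d) · sinh(ω_c(T−d)) / sinh(ω_c T)`. -/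
theorem stmt_11 (ωc T d : ℝ) (hωc : 0 < ωc) (hT : 0 < T) (hd0 : 0 ≤ d) (hdT : d < T)
    (a₀ : ℝ) (ha₀ : a₀ = Real.sinh (ωc * (T - d)) / Real.sinh (ωc * T))
    (g : ℝ → ℝ)
    (hg : ∀ τ, g τ =
      ωc * (Set.indicator (Set.Ico (0 : ℝ) (T - d)) (fun _ => (1 : ℝ)) τ *
              Real.exp (-(ωc * (T - d - τ))) -
            a₀ * Real.exp (-(ωc * (T - τ))))) :
    ∫ τ in (0 : ℝ)..T, (g τ) ^ 2 =
      ωc * Real.sinh (ωc * d) * Real.sinh (ωc * (T - d)) / Real.sinh (ωc * T) := by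
  have hne : ωc ≠ 0 := hωc.ne'
  have hleft : Set.EqOn (fun τ => (ωc * (Real.exp (-(ωc * (T - d))) -
      a₀ * Real.exp (-(ωc * T))) * Real.exp (ωc * τ)) ^ 2) (fun τ => g τ ^ 2)
      (Set.uIoo 0 (T - d)) := by
    intro τ hτ
    rw [Set.uIoo_of_le (by linarith)] at hτ
    have h₁ : -(ωc * (T - d - τ)) = -(ωc * (T - d)) + ωc * τ := by ring
    have h₂ : -(ωc * (T - τ)) = -(ωc * T) + ωc * τ := by ring
    simp only [hg, Set.indicator_of_mem (Set.Ioo_subset_Ico_self hτ), h₁, h₂, Real.exp_add]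
    ring
  have hright : Set.EqOn (fun τ => (ωc * (-a₀ * Real.exp (-(ωc * T))) * Real.exp (ωc * τ)) ^ 2)
      (fun τ => g τ ^ 2) (Set.uIoo (T - d) T) := by
    intro τ hτ
    rw [Set.uIoo_of_le (by linarith)] at hτ
    have hmem : τ ∉ Set.Ico 0 (T - d) := fun h => (h.2.trans hτ.1).false
    have h₂ : -(ωc * (T - τ)) = -(ωc * T) + ωc * τ := by ring
    simp only [hg, Set.indicator_of_notMem hmem, h₂, Real.exp_add]
    ring
  have hint (K a b : ℝ) : IntervalIntegrable (fun τ => (K * Real.exp (ωc * τ)) ^ 2)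
      MeasureTheory.volume a b :=
    Continuous.intervalIntegrable (by fun_prop) a b
  rw [← intervalIntegral.integral_add_adjacent_intervals ((hint _ _ _).congr_uIoo hleft)
      ((hint _ _ _).congr_uIoo hright),
    ← intervalIntegral.integral_congr_uIoo hleft, ← intervalIntegral.integral_congr_uIoo hright,
    integral_sq_const_mul_exp _ _ _ _ hne, integral_sq_const_mul_exp _ _ _ _ hne, ha₀]
  have hexp : Real.exp (ωc * T) = Real.exp (ωc * (T - d)) * Real.exp (ωc * d) := by
    rw [← Real.exp_add]
    ring_nf
  have hone : 1 < Real.exp (ωc * T) := Real.one_lt_exp_iff.mpr (by positivity)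
  simp only [Real.sinh_eq, Real.exp_neg, mul_zero, Real.exp_zero]
  rw [hexp] at hone ⊢
  have hp : 0 < Real.exp (ωc * (T - d)) := Real.exp_pos _
  have hq : 0 < Real.exp (ωc * d) := Real.exp_pos _
  generalize Real.exp (ωc * (T - d)) = p at *
  generalize Real.exp (ωc * d) = q at *
  have hden : p ^ 2 * q ^ 2 - 1 ≠ 0 := by nlinarith
  have hsinh : (p * q - (p * q)⁻¹) / 2 = (p ^ 2 * q ^ 2 - 1) / (2 * p * q) := by
    field_simp
  rw [hsinh]
  field_simp
  ring
end

section
/- For every real number a, ∫₀ᵀ g_a(τ)² dτ ≥ ∫₀ᵀ g_{a₀(d)}(τ)² dτ; that is, a₀(d) = sinh(ω_c(T−d))/sinh(ω_c T) minimizes a ↦ ∫₀ᵀ g_a(τ)² dτ over ℝ. -/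
open MeasureTheory Set

/-- The integral over `[0, b]` of an exponential of rate `2 w`, written with `sinh`. -/
theorem integral_exp_two_mul_eq_sinh {w : ℝ} (hw : w ≠ 0) (s b : ℝ) :
    ∫ τ in (0 : ℝ)..b, Real.exp (-(w * (s - 2 * τ))) =
      Real.exp (-(w * (s - b))) * Real.sinh (w * b) / w := by
  have hderiv : ∀ τ ∈ uIcc 0 b, HasDerivAt
      (fun τ => Real.exp (-(w * (s - 2 * τ))) / (2 * w)) (Real.exp (-(w * (s - 2 * τ)))) τ := by
    intro τ _
    have h := (((((hasDerivAt_id τ).const_mul 2).const_sub s).const_mul w).neg.exp).div_const (2 * w)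
    refine h.congr_deriv ?_
    simp only [id, Pi.neg_apply]
    field_simp
  have hcont : Continuous fun τ : ℝ => Real.exp (-(w * (s - 2 * τ))) := by fun_prop
  rw [intervalIntegral.integral_eq_sub_of_hasDerivAt hderiv (hcont.intervalIntegrable _ _),
    Real.sinh_eq,
    show -(w * (s - 2 * b)) = -(w * (s - b)) + w * b by ring,
    show -(w * (s - 2 * 0)) = -(w * (s - b)) + -(w * b) by ring, Real.exp_add, Real.exp_add]
  field_simp

/-- Integrating against the indicator of `[0, c)` truncates the interval of integration. -/
theorem intervalIntegral_indicator_Ico_mul {c T : ℝ} (hc : 0 ≤ c) (hcT : c ≤ T) (f : ℝ → ℝ) :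
    ∫ τ in (0 : ℝ)..T, (Ico (0 : ℝ) c).indicator (fun _ => (1 : ℝ)) τ * f τ =
      ∫ τ in (0 : ℝ)..c, f τ := by
  have h : (fun τ => (Ico (0 : ℝ) c).indicator (fun _ => (1 : ℝ)) τ * f τ) =
      (Ico (0 : ℝ) c).indicator f := by
    ext τ
    by_cases hτ : τ ∈ Ico (0 : ℝ) c <;> simp [hτ]
  rw [h, intervalIntegral.integral_of_le (hc.trans hcT), intervalIntegral.integral_of_le hc,
    ← integral_Ico_eq_integral_Ioc, ← integral_Ico_eq_integral_Ioc,
    setIntegral_indicator measurableSet_Ico,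
    inter_eq_self_of_subset_right (Ico_subset_Ico_right hcT)]

theorem intervalIntegrable_indicator_Ico_mul (c T : ℝ) {f : ℝ → ℝ} (hf : Continuous f) :
    IntervalIntegrable (fun τ => (Ico (0 : ℝ) c).indicator (fun _ => (1 : ℝ)) τ * f τ)
      volume 0 T := by
  have h : (fun τ => (Ico (0 : ℝ) c).indicator (fun _ => (1 : ℝ)) τ * f τ) =
      (Ico (0 : ℝ) c).indicator f := by
    ext τ
    by_cases hτ : τ ∈ Ico (0 : ℝ) c <;> simp [hτ]
  rw [h, intervalIntegrable_iff]
  exact (intervalIntegrable_iff.mp (hf.intervalIntegrable 0 T)).indicator measurableSet_Ico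


/-- with `g_a(τ) = ω_c (𝟙_{[0,T−d)}(τ) e^{−ω_c(T−d−τ)} − a e^{−ω_c(T−τ)})`,
the choice `a = a₀(d) = sinh(ω_c(T−d))/sinh(ω_c T)` minimizes `a ↦ ∫₀ᵀ g_a(τ)² dτ` over `ℝ`. -/
theorem stmt_12 (ωc T d : ℝ) (hωc : 0 < ωc) (hT : 0 < T) (hd0 : 0 ≤ d) (hdT : d < T)
    (a₀ : ℝ) (ha₀ : a₀ = Real.sinh (ωc * (T - d)) / Real.sinh (ωc * T))
    (g : ℝ → ℝ → ℝ)
    (hg : ∀ a τ, g a τ =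
      ωc * (Set.indicator (Set.Ico (0 : ℝ) (T - d)) (fun _ => (1 : ℝ)) τ *
              Real.exp (-(ωc * (T - d - τ))) -
            a * Real.exp (-(ωc * (T - τ))))) :
    ∀ a : ℝ, (∫ τ in (0 : ℝ)..T, (g a τ) ^ 2) ≥ ∫ τ in (0 : ℝ)..T, (g a₀ τ) ^ 2 := by
  intro a
  have hsinh : Real.sinh (ωc * T) ≠ 0 := (Real.sinh_pos_iff.mpr (mul_pos hωc hT)).ne'
  set χ : ℝ → ℝ := (Ico (0 : ℝ) (T - d)).indicator fun _ => (1 : ℝ) with hχ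
  have hχ_sq : ∀ τ, χ τ ^ 2 = χ τ := by
    intro τ
    by_cases hτ : τ ∈ Ico (0 : ℝ) (T - d) <;> simp [hχ, hτ]
  have hexp_mul : ∀ τ, Real.exp (-(ωc * (T - d - τ))) * Real.exp (-(ωc * (T - τ))) =
      Real.exp (-(ωc * (2 * T - d - 2 * τ))) := by
    intro τ
    rw [← Real.exp_add]
    ring_nf
  have hexp_sq : ∀ τ, Real.exp (-(ωc * (T - τ))) ^ 2 =
      Real.exp (-(ωc * (2 * T - 2 * τ))) := by
    intro τ
    rw [sq, ← Real.exp_add]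
    ring_nf
  have hsq : ∀ b τ, g b τ ^ 2 =
      ωc ^ 2 * (χ τ * Real.exp (-(ωc * (T - d - τ))) ^ 2) -
        2 * ωc ^ 2 * b * (χ τ * Real.exp (-(ωc * (2 * T - d - 2 * τ)))) +
        ωc ^ 2 * b ^ 2 * Real.exp (-(ωc * (2 * T - 2 * τ))) := by
    intro b τ
    rw [hg, ← hexp_mul, ← hexp_sq]
    linear_combination ωc ^ 2 * Real.exp (-(ωc * (T - d - τ))) ^ 2 * hχ_sq τ
  have hint_sq : IntervalIntegrable (fun τ => χ τ * Real.exp (-(ωc * (T - d - τ))) ^ 2)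
      volume 0 T :=
    intervalIntegrable_indicator_Ico_mul _ _ (by fun_prop)
  have hint_cross : IntervalIntegrable
      (fun τ => χ τ * Real.exp (-(ωc * (2 * T - d - 2 * τ)))) volume 0 T :=
    intervalIntegrable_indicator_Ico_mul _ _ (by fun_prop)
  have hint_exp : IntervalIntegrable (fun τ => Real.exp (-(ωc * (2 * T - 2 * τ))))
      volume 0 T :=
    Continuous.intervalIntegrable (by fun_prop) _ _
  have hcross : ∫ τ in (0 : ℝ)..T, χ τ * Real.exp (-(ωc * (2 * T - d - 2 * τ))) =
      a₀ * ∫ τ in (0 : ℝ)..T, Real.exp (-(ωc * (2 * T - 2 * τ))) := by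
    rw [intervalIntegral_indicator_Ico_mul (by linarith) (by linarith),
      integral_exp_two_mul_eq_sinh hωc.ne', integral_exp_two_mul_eq_sinh hωc.ne', ha₀,
      show 2 * T - d - (T - d) = T by ring, show 2 * T - T = T by ring]
    field_simp
  have hexp_nonneg : 0 ≤ ∫ τ in (0 : ℝ)..T, Real.exp (-(ωc * (2 * T - 2 * τ))) :=
    intervalIntegral.integral_nonneg hT.le fun _ _ => (Real.exp_pos _).le
  have hquad : ∀ b, ∫ τ in (0 : ℝ)..T, g b τ ^ 2 =
      ωc ^ 2 * (∫ τ in (0 : ℝ)..T, χ τ * Real.exp (-(ωc * (T - d - τ))) ^ 2) +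
        ωc ^ 2 * (b ^ 2 - 2 * b * a₀) *
          ∫ τ in (0 : ℝ)..T, Real.exp (-(ωc * (2 * T - 2 * τ))) := by
    intro b
    simp_rw [hsq]
    rw [intervalIntegral.integral_add ((hint_sq.const_mul _).sub (hint_cross.const_mul _))
        (hint_exp.const_mul _),
      intervalIntegral.integral_sub (hint_sq.const_mul _) (hint_cross.const_mul _),
      intervalIntegral.integral_const_mul, intervalIntegral.integral_const_mul,
      intervalIntegral.integral_const_mul, hcross]
    ring
  rw [hquad, hquad]
  nlinarith [mul_nonneg (mul_nonneg (sq_nonneg ωc) (sq_nonneg (a - a₀))) hexp_nonneg]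
end

section
/- The worst-case estimation error with the coefficients a₀(d), a₁(d) satisfies: sup over all x ∈ ℝ and w ∈ L²([0,T];ℝ) with x² + ‖w‖²_{L²} ≤ 1 of |v(T−d) − a₀(d) v(T) − a₁(d) v(0)| = sqrt( ω_c · sinh(ω_c d) · sinh(ω_c(T−d)) / sinh(ω_c T) ). -/
open MeasureTheory

/-- The response of the first-order low-pass filter `W(s) = ω_c/(s+ω_c)` with initial
state `x` and input `w`: `v(θ) = e^{−ω_c θ} x + ω_c ∫₀^θ e^{−ω_c(θ−τ)} w(τ) dτ`. -/
noncomputable def lowPassResponse (ωc T : ℝ) (x : ℝ)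
    (w : Lp ℝ 2 (volume.restrict (Set.Icc (0 : ℝ) T))) (θ : ℝ) : ℝ :=
  Real.exp (-(ωc * θ)) * x + ωc * ∫ τ in (0 : ℝ)..θ, Real.exp (-(ωc * (θ - τ))) * w τ

/-- For a vector `k` of a real inner product space, `‖k‖` is the largest value of `|⟪k, w⟫|`
over pairs `(x, w)` in the unit ball of the product with `ℝ`. -/
lemma isGreatest_abs_inner {E : Type*} [NormedAddCommGroup E] [InnerProductSpace ℝ E] (k : E) :
    IsGreatest {e : ℝ | ∃ (x : ℝ) (w : E), x ^ 2 + ‖w‖ ^ 2 ≤ 1 ∧ e = |inner ℝ k w|} ‖k‖ := by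
  constructor
  · refine ⟨0, ‖k‖⁻¹ • k, ?_, ?_⟩
    · rw [norm_smul, norm_inv, norm_norm]
      rcases eq_or_ne ‖k‖ 0 with h | h
      · simp [h]
      · simp [inv_mul_cancel₀ h]
    · rw [inner_smul_right, real_inner_self_eq_norm_sq]
      rcases eq_or_ne ‖k‖ 0 with h | h
      · simp [h]
      · rw [pow_two, inv_mul_cancel_left₀ h, abs_norm]
  · rintro e ⟨x, w, hw, rfl⟩
    have hw1 : ‖w‖ ≤ 1 := by nlinarith [sq_nonneg x, norm_nonneg w]
    exact (abs_real_inner_le_norm k w).trans (mul_le_of_le_one_right (norm_nonneg k) hw1)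

/-- The impulse response of the filter up to time `θ`, without the gain `ω_c`. -/
noncomputable def filterKernel (ωc θ : ℝ) : ℝ → ℝ :=
  (Set.Iic θ).indicator fun τ ↦ Real.exp (-(ωc * (θ - τ)))

lemma memLp_filterKernel (ωc T θ : ℝ) :
    MemLp (filterKernel ωc θ) 2 (volume.restrict (Set.Icc (0 : ℝ) T)) := by
  have hc : Continuous fun τ : ℝ ↦ Real.exp (-(ωc * (θ - τ))) := by fun_prop
  refine MemLp.indicator measurableSet_Iic ?_
  exact (memLp_two_iff_integrable_sq hc.aestronglyMeasurable).2
    (hc.pow 2).continuousOn.integrableOn_Icc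

/-- The kernel `filterKernel` as an element of `L²([0,T])`. -/
noncomputable def filterKernelLp (ωc T θ : ℝ) : Lp ℝ 2 (volume.restrict (Set.Icc (0 : ℝ) T)) :=
  (memLp_filterKernel ωc T θ).toLp

lemma inner_filterKernelLp (ωc : ℝ) {T θ : ℝ} (h0 : 0 ≤ θ) (hT : θ ≤ T)
    (w : Lp ℝ 2 (volume.restrict (Set.Icc (0 : ℝ) T))) :
    inner ℝ (filterKernelLp ωc T θ) w
      = ∫ τ in (0 : ℝ)..θ, Real.exp (-(ωc * (θ - τ))) * w τ := by
  have hs : Set.Icc (0 : ℝ) T ∩ Set.Iic θ = Set.Icc 0 θ := by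
    ext τ; simp only [Set.mem_inter_iff, Set.mem_Icc, Set.mem_Iic]; grind
  rw [L2.inner_def, intervalIntegral.integral_of_le h0, ← integral_Icc_eq_integral_Ioc, ← hs,
    ← setIntegral_indicator measurableSet_Iic]
  refine integral_congr_ae ?_
  filter_upwards [(memLp_filterKernel ωc T θ).coeFn_toLp] with τ hτ
  rw [filterKernelLp, hτ, filterKernel]
  by_cases h : τ ∈ Set.Iic θ <;> simp [h, mul_comm]

lemma lowPassResponse_eq_inner (ωc : ℝ) {T θ : ℝ} (h0 : 0 ≤ θ) (hT : θ ≤ T) (x : ℝ)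
    (w : Lp ℝ 2 (volume.restrict (Set.Icc (0 : ℝ) T))) :
    lowPassResponse ωc T x w θ
      = Real.exp (-(ωc * θ)) * x + ωc * inner ℝ (filterKernelLp ωc T θ) w := by
  rw [lowPassResponse, inner_filterKernelLp ωc h0 hT]

lemma inner_filterKernelLp_filterKernelLp {ωc T θ φ : ℝ} (hω : ωc ≠ 0) (h0 : 0 ≤ θ)
    (hθφ : θ ≤ φ) (hφT : φ ≤ T) :
    ωc * inner ℝ (filterKernelLp ωc T θ) (filterKernelLp ωc T φ)
      = Real.exp (-(ωc * φ)) * Real.sinh (ωc * θ) := by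
  have hint : ∫ τ in (0 : ℝ)..θ, Real.exp (-(ωc * (θ - τ))) * filterKernelLp ωc T φ τ
      = ∫ τ in (0 : ℝ)..θ, Real.exp (-(ωc * (θ - τ))) * Real.exp (-(ωc * (φ - τ))) := by
    refine intervalIntegral.integral_congr_ae ?_
    have h := (ae_restrict_iff' measurableSet_Icc).1 (memLp_filterKernel ωc T φ).coeFn_toLp
    filter_upwards [h] with τ hτ hmem
    rw [Set.uIoc_of_le h0] at hmem
    have hτφ : τ ∈ Set.Iic φ := hmem.2.trans hθφ
    rw [filterKernelLp, hτ ⟨hmem.1.le, hmem.2.trans (hθφ.trans hφT)⟩, filterKernel,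
      Set.indicator_of_mem hτφ]
  have hderiv : ∀ τ ∈ Set.uIcc 0 θ,
      HasDerivAt (fun τ ↦ (2 * ωc)⁻¹ * Real.exp (2 * ωc * τ - ωc * (θ + φ)))
        (Real.exp (-(ωc * (θ - τ))) * Real.exp (-(ωc * (φ - τ)))) τ := by
    intro τ _
    have h := ((((hasDerivAt_id τ).const_mul (2 * ωc)).sub_const (ωc * (θ + φ))).exp).const_mul
      (2 * ωc)⁻¹
    refine h.congr_deriv ?_
    rw [← Real.exp_add, id]
    have : -(ωc * (θ - τ)) + -(ωc * (φ - τ)) = 2 * ωc * τ - ωc * (θ + φ) := by ring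
    rw [this]
    field_simp
  rw [inner_filterKernelLp ωc h0 (hθφ.trans hφT), hint,
    intervalIntegral.integral_eq_sub_of_hasDerivAt hderiv
      (Continuous.intervalIntegrable (by fun_prop) _ _), Real.sinh_eq]
  have e1 : Real.exp (2 * ωc * θ - ωc * (θ + φ)) = Real.exp (-(ωc * φ)) * Real.exp (ωc * θ) := by
    rw [← Real.exp_add]; ring_nf
  have e2 : Real.exp (2 * ωc * 0 - ωc * (θ + φ))
      = Real.exp (-(ωc * φ)) * Real.exp (-(ωc * θ)) := by
    rw [← Real.exp_add]; ring_nf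
  rw [e1, e2]
  field_simp

/-- the worst-case estimation error with coefficients
`a₀(d) = sinh(ω_c(T−d))/sinh(ω_c T)` and `a₁(d) = e^{−ω_c T}(e^{ω_c d} − a₀(d))` over all
`(x, w)` with `x² + ‖w‖²_{L²} ≤ 1` equals
`sqrt(ω_c · sinh(ω_c d) · sinh(ω_c(T−d)) / sinh(ω_c T))`. -/
theorem stmt_13 (ωc T d : ℝ) (hωc : 0 < ωc) (hT : 0 < T) (hd0 : 0 ≤ d) (hdT : d < T)
    (a₀ a₁ : ℝ) (ha₀ : a₀ = Real.sinh (ωc * (T - d)) / Real.sinh (ωc * T))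
    (ha₁ : a₁ = Real.exp (-(ωc * T)) * (Real.exp (ωc * d) - a₀)) :
    sSup {e : ℝ |
        ∃ (x : ℝ) (w : Lp ℝ 2 (volume.restrict (Set.Icc (0 : ℝ) T))),
          x ^ 2 + ‖w‖ ^ 2 ≤ 1 ∧
          e = |lowPassResponse ωc T x w (T - d) - a₀ * lowPassResponse ωc T x w T -
                a₁ * lowPassResponse ωc T x w 0|} =
      Real.sqrt (ωc * Real.sinh (ωc * d) * Real.sinh (ωc * (T - d)) / Real.sinh (ωc * T)) := by
  set P := filterKernelLp ωc T (T - d) with hP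
  set Q := filterKernelLp ωc T T with hQ
  have herr : ∀ (x : ℝ) (w : Lp ℝ 2 (volume.restrict (Set.Icc (0 : ℝ) T))),
      lowPassResponse ωc T x w (T - d) - a₀ * lowPassResponse ωc T x w T -
        a₁ * lowPassResponse ωc T x w 0 = inner ℝ (ωc • (P - a₀ • Q)) w := by
    intro x w
    have h0 : lowPassResponse ωc T x w 0 = x := by simp [lowPassResponse]
    have he : Real.exp (-(ωc * (T - d))) = Real.exp (-(ωc * T)) * Real.exp (ωc * d) := by
      rw [← Real.exp_add]; ring_nf
    rw [h0, lowPassResponse_eq_inner ωc (by linarith) (by linarith),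
      lowPassResponse_eq_inner ωc hT.le le_rfl, real_inner_smul_left, inner_sub_left,
      real_inner_smul_left, ha₁, he]
    ring
  have hnorm : ‖ωc • (P - a₀ • Q)‖ ^ 2
      = ωc * Real.sinh (ωc * d) * Real.sinh (ωc * (T - d)) / Real.sinh (ωc * T) := by
    have hS : Real.sinh (ωc * T) ≠ 0 := (Real.sinh_pos_iff.2 (mul_pos hωc hT)).ne'
    have hPP := inner_filterKernelLp_filterKernelLp (T := T) hωc.ne' (sub_nonneg.2 hdT.le) le_rfl
      (sub_le_self T hd0)
    have hPQ := inner_filterKernelLp_filterKernelLp hωc.ne' (sub_nonneg.2 hdT.le)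
      (sub_le_self T hd0) le_rfl
    have hQQ := inner_filterKernelLp_filterKernelLp hωc.ne' hT.le le_rfl le_rfl
    rw [← hP] at hPP
    rw [← hP, ← hQ] at hPQ
    rw [← hQ] at hQQ
    have hexpand : ‖ωc • (P - a₀ • Q)‖ ^ 2 = ωc * (ωc * inner ℝ P P
        - 2 * a₀ * (ωc * inner ℝ P Q) + a₀ ^ 2 * (ωc * inner ℝ Q Q)) := by
      rw [← real_inner_self_eq_norm_sq]
      simp only [inner_smul_left, inner_smul_right, inner_sub_left, inner_sub_right,
        real_inner_comm P Q, conj_trivial]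
      ring
    have hsinh : Real.exp (-(ωc * (T - d))) * Real.sinh (ωc * T)
        - Real.exp (-(ωc * T)) * Real.sinh (ωc * (T - d)) = Real.sinh (ωc * d) := by
      have hd : ωc * d = ωc * T - ωc * (T - d) := by ring
      rw [hd, Real.sinh_sub, ← Real.cosh_sub_sinh, ← Real.cosh_sub_sinh]
      ring
    rw [hexpand, hPP, hPQ, hQQ, ha₀, ← hsinh]
    field_simp
    ring
  simp only [herr]
  rw [(isGreatest_abs_inner _).csSup_eq, ← hnorm, Real.sqrt_sq (norm_nonneg _)]
end

section
/- The minimax identity holds: the infimum over all pairs (α₀, α₁) ∈ ℝ² of [ sup over all x ∈ ℝ and w ∈ L²([0,T];ℝ) with x² + ‖w‖²_{L²} ≤ 1 of |v(T−d) − α₀ v(T) − α₁ v(0)| ] equals sqrt( ω_c · sinh(ω_c d) · sinh(ω_c(T−d)) / sinh(ω_c T) ), and this infimum is attained at (α₀, α₁) = (a₀(d), a₁(d)) with a₀(d) := sinh(ω_c(T−d))/sinh(ω_c T) and a₁(d) := e^{−ω_c T}(e^{ω_c d} − a₀(d)). -/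
open MeasureTheory

/-- The worst-case estimation error of the filter with coefficients `(α₀, α₁)` over all
`(x, w)` with `x² + ‖w‖²_{L²} ≤ 1`. -/
noncomputable def worstCaseError (ωc T d : ℝ) (α₀ α₁ : ℝ) : ℝ :=
  sSup {e : ℝ |
    ∃ (x : ℝ) (w : Lp ℝ 2 (volume.restrict (Set.Icc (0 : ℝ) T))),
      x ^ 2 + ‖w‖ ^ 2 ≤ 1 ∧
      e = |lowPassResponse ωc T x w (T - d) - α₀ * lowPassResponse ωc T x w T -
            α₁ * lowPassResponse ωc T x w 0|}

/-- The truncated exponential kernel representing the forced part of the response at `θ`. -/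
noncomputable def lowPassKernel (ωc θ : ℝ) : ℝ → ℝ :=
  (Set.Ioc 0 θ).indicator fun τ => ωc * Real.exp (-(ωc * (θ - τ)))

theorem memLp_lowPassKernel (ωc T θ : ℝ) :
    MemLp (lowPassKernel ωc θ) 2 (volume.restrict (Set.Icc (0 : ℝ) T)) := by
  have hc : Continuous fun τ : ℝ => ωc * Real.exp (-(ωc * (θ - τ))) := by fun_prop
  obtain ⟨C, hC⟩ := isCompact_Icc.exists_bound_of_continuousOn (s := Set.Icc (0 : ℝ) T)
    hc.continuousOn
  exact (MemLp.of_bound hc.aestronglyMeasurable C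
    ((ae_restrict_iff' measurableSet_Icc).2 (.of_forall hC))).indicator measurableSet_Ioc

/-- The kernel `lowPassKernel` as an element of `L²([0,T])`. -/
noncomputable def lowPassKernelLp (ωc T θ : ℝ) :
    Lp ℝ 2 (volume.restrict (Set.Icc (0 : ℝ) T)) :=
  (memLp_lowPassKernel ωc T θ).toLp

theorem inner_lowPassKernelLp (ωc : ℝ) {T θ : ℝ} (h0 : 0 ≤ θ) (hT : θ ≤ T)
    (w : Lp ℝ 2 (volume.restrict (Set.Icc (0 : ℝ) T))) :
    inner ℝ (lowPassKernelLp ωc T θ) w =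
      ωc * ∫ τ in (0 : ℝ)..θ, Real.exp (-(ωc * (θ - τ))) * w τ := by
  have hsub : Set.Ioc 0 θ ⊆ Set.Icc 0 T := fun τ hτ => ⟨hτ.1.le, hτ.2.trans hT⟩
  rw [L2.inner_def, intervalIntegral.integral_of_le h0, ← integral_const_mul]
  have h : (fun τ => inner ℝ (lowPassKernelLp ωc T θ τ) (w τ))
      =ᵐ[volume.restrict (Set.Icc (0 : ℝ) T)]
      (Set.Ioc 0 θ).indicator fun τ => ωc * (Real.exp (-(ωc * (θ - τ))) * w τ) := by
    filter_upwards [(memLp_lowPassKernel ωc T θ).coeFn_toLp] with τ hτ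
    rw [lowPassKernelLp, hτ, lowPassKernel]
    by_cases hm : τ ∈ Set.Ioc 0 θ <;> simp [hm]
    ring
  rw [integral_congr_ae h, integral_indicator measurableSet_Ioc,
    Measure.restrict_restrict measurableSet_Ioc, Set.inter_eq_left.2 hsub]

theorem integral_exp_mul_exp (ωc θ η : ℝ) :
    ∫ τ in (0 : ℝ)..θ, Real.exp (-(ωc * (θ - τ))) * (ωc * Real.exp (-(ωc * (η - τ)))) =
      Real.exp (-(ωc * η)) * Real.sinh (ωc * θ) := by
  have hderiv : ∀ τ ∈ Set.uIcc 0 θ, HasDerivAt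
      (fun τ => Real.exp (-(ωc * (θ - τ))) * Real.exp (-(ωc * (η - τ))) / 2)
      (Real.exp (-(ωc * (θ - τ))) * (ωc * Real.exp (-(ωc * (η - τ))))) τ := by
    intro τ _
    have h (a : ℝ) : HasDerivAt (fun τ => Real.exp (-(ωc * (a - τ))))
        (Real.exp (-(ωc * (a - τ))) * ωc) τ := by
      refine (((hasDerivAt_id τ).const_sub a).const_mul ωc).neg.exp.congr_deriv ?_
      simp
    refine (((h θ).mul (h η)).div_const 2).congr_deriv ?_
    ring
  rw [intervalIntegral.integral_eq_sub_of_hasDerivAt hderiv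
    (Continuous.intervalIntegrable (by fun_prop) _ _), Real.sinh_eq]
  have h1 : Real.exp (-(ωc * (η - θ))) = Real.exp (-(ωc * η)) * Real.exp (ωc * θ) := by
    rw [← Real.exp_add]; ring_nf
  simp only [sub_self, mul_zero, neg_zero, Real.exp_zero, sub_zero, h1]
  ring

theorem inner_lowPassKernelLp_lowPassKernelLp {ωc T θ η : ℝ} (h0 : 0 ≤ θ) (hθη : θ ≤ η)
    (hηT : η ≤ T) :
    inner ℝ (lowPassKernelLp ωc T θ) (lowPassKernelLp ωc T η) =
      ωc * (Real.exp (-(ωc * η)) * Real.sinh (ωc * θ)) := by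
  rw [inner_lowPassKernelLp ωc h0 (hθη.trans hηT), ← integral_exp_mul_exp,
    intervalIntegral.integral_of_le h0, intervalIntegral.integral_of_le h0]
  have hsub : Set.Ioc 0 θ ⊆ Set.Icc 0 T := fun τ hτ => ⟨hτ.1.le, hτ.2.trans (hθη.trans hηT)⟩
  congr 1
  refine integral_congr_ae ?_
  filter_upwards [ae_restrict_of_ae_restrict_of_subset hsub
    (memLp_lowPassKernel ωc T η).coeFn_toLp, ae_restrict_mem measurableSet_Ioc] with τ hτ hm
  rw [lowPassKernelLp, hτ, lowPassKernel,
    Set.indicator_of_mem (Set.mem_Ioc.2 ⟨hm.1, hm.2.trans hθη⟩)]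

theorem sSup_abs_mul_add_inner {H : Type*} [NormedAddCommGroup H] [InnerProductSpace ℝ H]
    (c : ℝ) (g : H) :
    sSup {e : ℝ | ∃ (x : ℝ) (w : H), x ^ 2 + ‖w‖ ^ 2 ≤ 1 ∧ e = |c * x + inner ℝ g w|} =
      √(c ^ 2 + ‖g‖ ^ 2) := by
  set N := √(c ^ 2 + ‖g‖ ^ 2) with hN
  have hN2 : N * N = c ^ 2 + ‖g‖ ^ 2 := Real.mul_self_sqrt (by positivity)
  have hN0 : 0 ≤ N := Real.sqrt_nonneg _
  refine IsGreatest.csSup_eq ⟨⟨c / N, N⁻¹ • g, ?_, ?_⟩, ?_⟩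
  · rw [norm_smul, mul_pow, norm_inv, inv_pow, Real.norm_eq_abs, sq_abs, div_pow, ← div_eq_inv_mul,
      ← add_div, ← hN2, sq]
    exact div_self_le_one _
  · rw [inner_smul_right, real_inner_self_eq_norm_sq]
    have : c * (c / N) + N⁻¹ * ‖g‖ ^ 2 = N * N / N := by rw [hN2]; ring
    rw [this, mul_self_div_self, abs_of_nonneg hN0]
  · rintro _ ⟨x, w, hxw, rfl⟩
    refine (abs_add_le _ _).trans (Real.le_sqrt_of_sq_le ?_)
    have hi := abs_real_inner_le_norm g w
    rw [abs_mul]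
    calc (|c| * |x| + |inner ℝ g w|) ^ 2 ≤ (|c| * |x| + ‖g‖ * ‖w‖) ^ 2 := by gcongr
      _ ≤ (|c| ^ 2 + ‖g‖ ^ 2) * (|x| ^ 2 + ‖w‖ ^ 2) := by
        nlinarith [sq_nonneg (|c| * ‖w‖ - ‖g‖ * |x|)]
      _ ≤ c ^ 2 + ‖g‖ ^ 2 := by
        rw [sq_abs, sq_abs]
        exact mul_le_of_le_one_right (by positivity) hxw

theorem worstCaseError_eq {ωc T d : ℝ} (hT : 0 < T) (hd0 : 0 ≤ d)
    (hdT : d < T) (α₀ α₁ : ℝ) :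
    worstCaseError ωc T d α₀ α₁ =
      √((Real.exp (-(ωc * (T - d))) - α₀ * Real.exp (-(ωc * T)) - α₁) ^ 2 +
        ωc * (Real.exp (-(ωc * (T - d))) * Real.sinh (ωc * (T - d)) -
          2 * α₀ * (Real.exp (-(ωc * T)) * Real.sinh (ωc * (T - d))) +
          α₀ ^ 2 * (Real.exp (-(ωc * T)) * Real.sinh (ωc * T)))) := by
  have hs : 0 ≤ T - d := by linarith
  have hsT : T - d ≤ T := by linarith
  set g := lowPassKernelLp ωc T (T - d) - α₀ • lowPassKernelLp ωc T T with hg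
  have hnorm : ‖g‖ ^ 2 = ωc * (Real.exp (-(ωc * (T - d))) * Real.sinh (ωc * (T - d)) -
          2 * α₀ * (Real.exp (-(ωc * T)) * Real.sinh (ωc * (T - d))) +
          α₀ ^ 2 * (Real.exp (-(ωc * T)) * Real.sinh (ωc * T))) := by
    rw [hg, norm_sub_sq_real, ← real_inner_self_eq_norm_sq, ← real_inner_self_eq_norm_sq,
      inner_smul_left, inner_smul_right, inner_smul_right,
      inner_lowPassKernelLp_lowPassKernelLp hs le_rfl hsT,
      inner_lowPassKernelLp_lowPassKernelLp hs hsT le_rfl,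
      inner_lowPassKernelLp_lowPassKernelLp hT.le le_rfl le_rfl]
    simp only [conj_trivial]
    ring
  rw [← hnorm, ← sSup_abs_mul_add_inner, worstCaseError]
  congr! 10 with e x w
  rw [hg, inner_sub_left, inner_smul_left, inner_lowPassKernelLp ωc hs hsT,
    inner_lowPassKernelLp ωc hT.le le_rfl]
  simp only [lowPassResponse, conj_trivial, mul_zero, neg_zero, Real.exp_zero,
    intervalIntegral.integral_same]
  ring

/-- the minimax identity: the infimum over `(α₀, α₁) ∈ ℝ²` of the worst-case
estimation error equals `sqrt(ω_c · sinh(ω_c d) · sinh(ω_c(T−d)) / sinh(ω_c T))`, and it is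
attained at `(α₀, α₁) = (a₀(d), a₁(d))` with `a₀(d) = sinh(ω_c(T−d))/sinh(ω_c T)` and
`a₁(d) = e^{−ω_c T}(e^{ω_c d} − a₀(d))`. -/
theorem stmt_14 (ωc T d : ℝ) (hωc : 0 < ωc) (hT : 0 < T) (hd0 : 0 ≤ d) (hdT : d < T)
    (a₀ a₁ : ℝ) (ha₀ : a₀ = Real.sinh (ωc * (T - d)) / Real.sinh (ωc * T))
    (ha₁ : a₁ = Real.exp (-(ωc * T)) * (Real.exp (ωc * d) - a₀)) :
    sInf {e : ℝ | ∃ α₀ α₁ : ℝ, e = worstCaseError ωc T d α₀ α₁} =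
      Real.sqrt (ωc * Real.sinh (ωc * d) * Real.sinh (ωc * (T - d)) / Real.sinh (ωc * T)) ∧
    worstCaseError ωc T d a₀ a₁ =
      Real.sqrt (ωc * Real.sinh (ωc * d) * Real.sinh (ωc * (T - d)) / Real.sinh (ωc * T)) := by
  have hS : 0 < Real.sinh (ωc * T) := Real.sinh_pos_iff.2 (by positivity)
  have hkey : Real.exp (-(ωc * (T - d))) * Real.sinh (ωc * T) -
      Real.exp (-(ωc * T)) * Real.sinh (ωc * (T - d)) = Real.sinh (ωc * d) := by
    simp only [Real.sinh_eq, mul_sub, mul_div_assoc', ← Real.exp_add]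
    ring_nf
  have hsq (α₀ : ℝ) : ωc * (Real.exp (-(ωc * (T - d))) * Real.sinh (ωc * (T - d)) -
          2 * α₀ * (Real.exp (-(ωc * T)) * Real.sinh (ωc * (T - d))) +
          α₀ ^ 2 * (Real.exp (-(ωc * T)) * Real.sinh (ωc * T))) =
      ωc * Real.sinh (ωc * d) * Real.sinh (ωc * (T - d)) / Real.sinh (ωc * T) +
        ωc * Real.exp (-(ωc * T)) * Real.sinh (ωc * T) * (α₀ - a₀) ^ 2 := by
    rw [← hkey, ha₀]
    field_simp
    ring
  have hopt : worstCaseError ωc T d a₀ a₁ =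
      √(ωc * Real.sinh (ωc * d) * Real.sinh (ωc * (T - d)) / Real.sinh (ωc * T)) := by
    have hc : Real.exp (-(ωc * (T - d))) - a₀ * Real.exp (-(ωc * T)) - a₁ = 0 := by
      have : Real.exp (-(ωc * (T - d))) = Real.exp (-(ωc * T)) * Real.exp (ωc * d) := by
        rw [← Real.exp_add]; ring_nf
      rw [ha₁, this]
      ring
    rw [worstCaseError_eq hT hd0 hdT, hsq, hc]
    simp
  refine ⟨IsLeast.csInf_eq ⟨⟨a₀, a₁, hopt.symm⟩, ?_⟩, hopt⟩
  rintro _ ⟨α₀, α₁, rfl⟩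
  rw [worstCaseError_eq hT hd0 hdT, hsq]
  refine Real.sqrt_le_sqrt ?_
  rw [add_left_comm]
  exact le_add_of_nonneg_right (by positivity)
end

section
/- Fix T > 0 and 0 < d < T. As ω_c → ∞, both optimal filter coefficients tend to zero: a₀(d) = sinh(ω_c(T−d))/sinh(ω_c T) → 0 and a₁(d) = e^{−ω_c T}(e^{ω_c d} − a₀(d)) → 0. -/
open Filter

lemma sinh_div_sinh_le_exp_sub {a b : ℝ} (hab : a ≤ b) (hb : 0 < b) :
    Real.sinh a / Real.sinh b ≤ Real.exp (a - b) := by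
  rw [div_le_iff₀ (Real.sinh_pos_iff.2 hb), Real.sinh_eq, Real.sinh_eq, mul_div_assoc',
    mul_sub, ← Real.exp_add, ← Real.exp_add, sub_add_cancel]
  have h : Real.exp (a - b + -b) ≤ Real.exp (-a) := Real.exp_le_exp.2 (by linarith)
  linarith

lemma tendsto_exp_neg_mul_const_atTop {c : ℝ} (hc : 0 < c) :
    Tendsto (fun x : ℝ => Real.exp (-(x * c))) atTop (nhds 0) :=
  Real.tendsto_exp_neg_atTop_nhds_zero.comp (tendsto_id.atTop_mul_const hc)

/-- for fixed `T > 0` and `0 < d < T`, as `ω_c → ∞` both optimal filter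
coefficients `a₀(d) = sinh(ω_c(T−d))/sinh(ω_c T)` and
`a₁(d) = e^{−ω_c T}(e^{ω_c d} − a₀(d))` tend to zero. -/
theorem stmt_16 (T d : ℝ) (hT : 0 < T) (hd0 : 0 < d) (hdT : d < T) :
    Tendsto (fun ωc : ℝ => Real.sinh (ωc * (T - d)) / Real.sinh (ωc * T))
      atTop (nhds 0) ∧
    Tendsto (fun ωc : ℝ =>
        Real.exp (-(ωc * T)) *
          (Real.exp (ωc * d) - Real.sinh (ωc * (T - d)) / Real.sinh (ωc * T)))
      atTop (nhds 0) := by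
  have h₀ : Tendsto (fun ωc : ℝ => Real.sinh (ωc * (T - d)) / Real.sinh (ωc * T))
      atTop (nhds 0) := by
    refine squeeze_zero' ?_ ?_ (tendsto_exp_neg_mul_const_atTop hd0)
    · filter_upwards [eventually_gt_atTop 0] with x hx
      exact div_nonneg (Real.sinh_nonneg_iff.2 (mul_nonneg hx.le (sub_nonneg.2 hdT.le)))
        (Real.sinh_nonneg_iff.2 (mul_pos hx hT).le)
    · filter_upwards [eventually_gt_atTop 0] with x hx
      have h := sinh_div_sinh_le_exp_sub (a := x * (T - d)) (b := x * T)
        (by nlinarith) (mul_pos hx hT)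
      rwa [show x * (T - d) - x * T = -(x * d) by ring] at h
  refine ⟨h₀, ?_⟩
  have h := (tendsto_exp_neg_mul_const_atTop (sub_pos.2 hdT)).sub
    ((tendsto_exp_neg_mul_const_atTop hT).mul h₀)
  rw [mul_zero, sub_zero] at h
  refine h.congr fun x => ?_
  rw [mul_sub (Real.exp _), ← Real.exp_add, show -(x * T) + x * d = -(x * (T - d)) by ring]
end
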